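/- arXiv:1002.2905 — 2 statements merged into one kernel-verified Lean document; each statement's English description precedes it below -/
import Mathlib

section
/- Let G be a finite abelian group with identity e, exponent N, and let S be a subset of G not containing e. Assign to each arc (g, gs) of the Cayley digraph Cay(G; S) the voltage φ((g, gs)) = exp(2πi/ord(s)), an N-th root of unity. Then S is weakly half factorial if and only if this voltage digraph satisfies Kirchhoff's Voltage Law, i.e., for every closed directed path with arcs colored s_1, …, s_k the product Π_{i=1}^k exp(2πi/ord(s_i)) equals 1. -/
/-- A block over `S`: a nonempty list of elements of `S` whose product is the identity. -/
def IsBlockOn {G : Type*} [CommGroup G] (S : Set G) (l : List G) : Prop :=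
  l ≠ [] ∧ (∀ s ∈ l, s ∈ S) ∧ l.prod = 1

/-- An atom over `S`: a block over `S` no proper nonempty subsequence of which has product `1`. -/
def IsAtomOn {G : Type*} [CommGroup G] (S : Set G) (l : List G) : Prop :=
  IsBlockOn S l ∧ ∀ t : List G, t.Sublist l → t ≠ [] → t ≠ l → t.prod ≠ 1

/-- The cross number of a block: the sum of the reciprocals of the orders of its terms. -/
noncomputable def crossNum {G : Type*} [CommGroup G] (l : List G) : ℚ :=
  (l.map fun g => ((orderOf g : ℚ))⁻¹).sum

/-- The vertices visited by the walk in `Cay(G;S)` starting at `x` whose arcs are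
colored, in order, by the terms of `l`. -/
def cayVerts {G : Type*} [CommGroup G] (x : G) (l : List G) : List G :=
  l.scanl (· * ·) x

/-- A directed path in the Cayley digraph `Cay(G;S)` starting at `x`, recorded by the list
of colors of its consecutive arcs: it is nonempty, all colors lie in `S`, and all visited
vertices are distinct except possibly the first and the last. -/
def IsCayleyPath {G : Type*} [CommGroup G] (S : Set G) (x : G) (l : List G) : Prop :=
  l ≠ [] ∧ (∀ s ∈ l, s ∈ S) ∧ (cayVerts x l).dropLast.Nodup ∧ (cayVerts x l).tail.Nodup

/-- The ending vertex of the walk starting at `x` with arc colors `l`. -/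
def cayEnd {G : Type*} [CommGroup G] (x : G) (l : List G) : G :=
  (cayVerts x l).getLastD x

/-- `S` is weakly half factorial if every atom over `S` has integer cross number. -/
def IsWeaklyHalfFactorial {G : Type*} [CommGroup G] (S : Set G) : Prop :=
  ∀ l : List G, IsAtomOn S l → ∃ n : ℤ, crossNum l = n

/-- The total voltage along a walk whose arcs are colored by the terms of `l`, where the
arc `(g, gs)` carries the voltage `exp(2πi / ord(s))`, an `N`-th root of unity for `N`
the exponent of `G`. -/
noncomputable def cayVoltage {G : Type*} [CommGroup G] (l : List G) : ℂ :=
  (l.map fun s => Complex.exp (2 * (Real.pi : ℂ) * Complex.I / ((orderOf s : ℕ) : ℂ))).prod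

theorem cayVerts_nil {G : Type*} [CommGroup G] (x : G) : cayVerts x [] = [x] := rfl

theorem cayVerts_cons {G : Type*} [CommGroup G] (x a : G) (l : List G) :
    cayVerts x (a :: l) = x :: cayVerts (x * a) l := by
  simp [cayVerts, List.scanl_cons]

theorem cayVerts_ne_nil {G : Type*} [CommGroup G] (x : G) (l : List G) :
    cayVerts x l ≠ [] := by
  cases l <;> simp [cayVerts_nil, cayVerts_cons]

theorem cayVerts_dropLast {G : Type*} [CommGroup G] (x : G) {l : List G} (hl : l ≠ []) :
    (cayVerts x l).dropLast = cayVerts x l.dropLast := by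
  induction l generalizing x with
  | nil => exact absurd rfl hl
  | cons a l ih =>
    rw [cayVerts_cons, List.dropLast_cons_of_ne_nil (cayVerts_ne_nil _ _)]
    rcases eq_or_ne l [] with rfl | h
    · simp [cayVerts_nil]
    · rw [ih _ h, List.dropLast_cons_of_ne_nil h, cayVerts_cons]

theorem cayEnd_eq_mul_prod {G : Type*} [CommGroup G] (x : G) (l : List G) :
    cayEnd x l = x * l.prod := by
  have key : ∀ (y : G), (cayVerts x l).getLastD y = x * l.prod := by
    induction l generalizing x with
    | nil => simp [cayVerts_nil]
    | cons a l ih =>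
      intro y
      rw [cayVerts_cons, List.getLastD_cons, ih, List.prod_cons, mul_assoc]
  exact key x

/-- Every visited vertex is the starting vertex times the product of a subsequence of colors. -/
theorem exists_sublist_of_mem_cayVerts {G : Type*} [CommGroup G] {x y : G} {l : List G}
    (h : y ∈ cayVerts x l) : ∃ t : List G, t.Sublist l ∧ y = x * t.prod := by
  induction l generalizing x with
  | nil => exact ⟨[], List.Sublist.refl _, by simpa [cayVerts_nil] using h⟩
  | cons a l ih =>
    rw [cayVerts_cons, List.mem_cons] at h
    rcases h with rfl | h
    · exact ⟨[], List.nil_sublist _, by simp⟩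
    · obtain ⟨t, ht, rfl⟩ := ih h
      exact ⟨a :: t, ht.cons_cons a, by rw [List.prod_cons, mul_assoc]⟩

/-- A walk no nonempty subsequence of whose colors has product `1` visits distinct vertices. -/
theorem cayVerts_nodup {G : Type*} [CommGroup G] (x : G) {l : List G}
    (h : ∀ t : List G, t.Sublist l → t ≠ [] → t.prod ≠ 1) : (cayVerts x l).Nodup := by
  induction l generalizing x with
  | nil => simp [cayVerts_nil]
  | cons a l ih =>
    rw [cayVerts_cons, List.nodup_cons]
    refine ⟨fun hx => ?_, ih _ fun t ht => h t (ht.cons a)⟩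
    obtain ⟨t, ht, hxt⟩ := exists_sublist_of_mem_cayVerts hx
    refine h (a :: t) (ht.cons_cons a) (List.cons_ne_nil _ _) ?_
    rw [List.prod_cons]
    exact mul_eq_left.mp (by rw [← mul_assoc]; exact hxt.symm)

/-- Following the colors of an atom traces a directed path from any vertex. -/
theorem IsAtomOn.isCayleyPath {G : Type*} [CommGroup G] {S : Set G} {l : List G}
    (h : IsAtomOn S l) (x : G) : IsCayleyPath S x l := by
  obtain ⟨⟨hne, hS, -⟩, hmin⟩ := h
  have short : ∀ m : List G, m.Sublist l → m.length < l.length →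
      ∀ t : List G, t.Sublist m → t ≠ [] → t.prod ≠ 1 := by
    intro m hm hlt t ht h0
    refine hmin t (ht.trans hm) h0 ?_
    rintro rfl
    exact absurd ht.length_le (by omega)
  have hpos := List.length_pos_iff.mpr hne
  refine ⟨hne, hS, ?_, ?_⟩
  · rw [cayVerts_dropLast x hne]
    exact cayVerts_nodup x (short _ (List.dropLast_sublist l) (by rw [List.length_dropLast]; omega))
  · cases l with
    | nil => exact absurd rfl hne
    | cons a l =>
      rw [cayVerts_cons, List.tail_cons]
      exact cayVerts_nodup _ (short l (List.sublist_cons_self a l) (by simp))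

theorem cayVoltage_eq_exp {G : Type*} [CommGroup G] (l : List G) :
    cayVoltage l = Complex.exp ((crossNum l : ℂ) * (2 * (Real.pi : ℂ) * Complex.I)) := by
  induction l with
  | nil => simp [cayVoltage, crossNum]
  | cons a l ih =>
    simp only [cayVoltage, crossNum, List.map_cons, List.prod_cons, List.sum_cons] at ih ⊢
    rw [ih, ← Complex.exp_add]
    push_cast
    congr 1
    ring

theorem cayVoltage_eq_one_iff {G : Type*} [CommGroup G] (l : List G) :
    cayVoltage l = 1 ↔ ∃ n : ℤ, crossNum l = n := by
  rw [cayVoltage_eq_exp, Complex.exp_eq_one_iff]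
  refine exists_congr fun n => ?_
  rw [mul_left_inj' Complex.two_pi_I_ne_zero]
  norm_cast

/-- If every atom over `S` has integer cross number, then so does every block over `S`. -/
theorem IsWeaklyHalfFactorial.exists_crossNum_eq {G : Type*} [CommGroup G] {S : Set G}
    (h : IsWeaklyHalfFactorial S) (l : List G) (hS : ∀ s ∈ l, s ∈ S) (hl : l.prod = 1) :
    ∃ n : ℤ, crossNum l = n := by
  induction hk : l.length using Nat.strong_induction_on generalizing l with
  | _ k ih =>
    subst hk
    rcases eq_or_ne l [] with rfl | hne
    · exact ⟨0, by simp [crossNum]⟩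
    by_cases hmin : ∀ t : List G, t.Sublist l → t ≠ [] → t ≠ l → t.prod ≠ 1
    · exact h l ⟨⟨hne, hS, hl⟩, hmin⟩
    push Not at hmin
    obtain ⟨t, ht, ht0, htl, htp⟩ := hmin
    obtain ⟨r, hr⟩ := ht.exists_perm_append
    have hlen : l.length = t.length + r.length := by simpa using hr.length_eq
    have htlt : t.length < l.length :=
      lt_of_le_of_ne ht.length_le fun e => htl (ht.eq_of_length e)
    have htpos := List.length_pos_iff.mpr ht0
    have hrp : r.prod = 1 := by
      have hp := hr.prod_eq
      rwa [List.prod_append, hl, htp, one_mul, eq_comm] at hp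
    obtain ⟨m, hm⟩ := ih _ htlt t (fun s hs => hS s (ht.subset hs)) htp rfl
    obtain ⟨n, hn⟩ := ih _ (by omega) r
      (fun s hs => hS s (hr.mem_iff.mpr (List.mem_append_right t hs))) hrp rfl
    refine ⟨m + n, ?_⟩
    have hsum : crossNum l = crossNum t + crossNum r := by
      unfold crossNum
      rw [(hr.map _).sum_eq, List.map_append, List.sum_append]
    rw [hsum, hm, hn, Int.cast_add]

/-- `S` is weakly half factorial iff the voltage digraph
`(Cay(G;S), φ, C_N)` with `φ((g, gs)) = exp(2πi / ord(s))` satisfies Kirchhoff's Voltage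
Law: the total voltage along every closed directed path equals `1`. -/
theorem weaklyHalfFactorial_iff_KVL {G : Type*} [CommGroup G] [Fintype G]
    (S : Set G) (hS : (1 : G) ∉ S) :
    IsWeaklyHalfFactorial S ↔
      ∀ (x : G) (l : List G), IsCayleyPath S x l → cayEnd x l = x → cayVoltage l = 1 := by
  constructor
  · rintro h x l ⟨-, hl, -⟩ hend
    rw [cayEnd_eq_mul_prod, mul_eq_left] at hend
    exact (cayVoltage_eq_one_iff l).mpr (h.exists_crossNum_eq l hl hend)
  · intro h l hl
    refine (cayVoltage_eq_one_iff l).mp (h 1 l (hl.isCayleyPath 1) ?_)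
    rw [cayEnd_eq_mul_prod, hl.1.2.2, mul_one]
end

section
/- Let G = (V, E) be a finite simple graph with a positive length function on its edges and maximum degree Δ(G). Then the edge set E can be covered by Δ(G) + 1 geodetical spanning subgraphs; that is, t(G) ≤ Δ(G) + 1. -/
/-- A path in a graph: a walk with at least one edge, no repeated edges, and all vertices
distinct except possibly the first and the last. -/
def IsGraphPath {V : Type*} (G : SimpleGraph V) {x y : V} (w : G.Walk x y) : Prop :=
  1 ≤ w.length ∧ w.edges.Nodup ∧ w.support.dropLast.Nodup ∧ w.support.tail.Nodup

/-- The total length of a walk, with respect to the edge length function `lam`. -/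
def walkLength {V : Type*} (lam : Sym2 V → ℝ) {G : SimpleGraph V} {x y : V}
    (w : G.Walk x y) : ℝ :=
  (w.edges.map lam).sum

/-- A weighted graph is geodetical if for every pair of vertices `x, y`, all paths from `x`
to `y` have the same total length. -/
def Geodetical {V : Type*} (G : SimpleGraph V) (lam : Sym2 V → ℝ) : Prop :=
  ∀ (x y : V) (w₁ w₂ : G.Walk x y), IsGraphPath G w₁ → IsGraphPath G w₂ →
    walkLength lam w₁ = walkLength lam w₂

/-- A graph has the unique path property if for every pair of vertices `x, y` there is at
most one path from `x` to `y`. -/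
def UniquePathProp {V : Type*} (G : SimpleGraph V) : Prop :=
  ∀ (x y : V) (w₁ w₂ : G.Walk x y), IsGraphPath G w₁ → IsGraphPath G w₂ → w₁ = w₂

/-- An edge coloring of `G` is proper if distinct edges sharing a vertex receive distinct
colors. -/
def ProperEdgeColoring {V C : Type*} (G : SimpleGraph V) (c : Sym2 V → C) : Prop :=
  ∀ e₁ ∈ G.edgeSet, ∀ e₂ ∈ G.edgeSet, e₁ ≠ e₂ → (∃ v, v ∈ e₁ ∧ v ∈ e₂) → c e₁ ≠ c e₂

/-- The edge-chromatic number of `G`: the least `k` such that `G` admits a proper edge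
coloring with `k` colors. -/
noncomputable def edgeChromaticNumber {V : Type*} (G : SimpleGraph V) : ℕ :=
  sInf {k : ℕ | ∃ c : Sym2 V → Fin k, ProperEdgeColoring G c}

/-- `t(G)`: the minimal number of geodetical subgraphs of `G` whose edge sets cover the
edge set of `G`. -/
noncomputable def coverNumber {V : Type*} (G : SimpleGraph V) (lam : Sym2 V → ℝ) : ℕ :=
  sInf {t : ℕ | ∃ f : Fin t → SimpleGraph V,
    (∀ i, f i ≤ G ∧ Geodetical (f i) lam) ∧
    ∀ e ∈ G.edgeSet, ∃ i, e ∈ (f i).edgeSet}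

/-- A graph is acyclic if every vertex has at most one smaller neighbor. -/
theorem SimpleGraph.isAcyclic_of_unique_smaller_neighbor {V : Type*} [LinearOrder V]
    (G : SimpleGraph V)
    (h : ∀ v u w, G.Adj v u → G.Adj v w → u < v → w < v → u = w) : G.IsAcyclic := by
  intro a p hp
  obtain ⟨v, hv, hmax⟩ := p.support.toFinset.exists_max_image id ⟨a, by simp⟩
  rw [List.mem_toFinset] at hv
  have hq := hp.rotate hv
  have hle : ∀ u ∈ (p.rotate v hv).support, u ≤ v := fun u hu =>
    hmax u (by simpa using hu)
  have hsnd := (p.rotate v hv).adj_snd hq.not_nil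
  have hpen := ((p.rotate v hv).adj_penultimate hq.not_nil).symm
  exact hq.snd_ne_penultimate <| h v _ _ hsnd hpen
    (lt_of_le_of_ne (hle _ ((p.rotate v hv).getVert_mem_support _)) hsnd.ne')
    (lt_of_le_of_ne (hle _ ((p.rotate v hv).getVert_mem_support _)) hpen.ne')

theorem IsGraphPath.isPath {V : Type*} {G : SimpleGraph V} {x y : V} {w : G.Walk x y}
    (hw : IsGraphPath G w) (hxy : x ≠ y) : w.IsPath := by
  obtain ⟨-, -, hd, ht⟩ := hw
  cases w with
  | nil => exact absurd rfl hxy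
  | cons hadj p =>
    simp only [SimpleGraph.Walk.support_cons, List.tail_cons] at ht hd
    rw [List.dropLast_cons_of_ne_nil p.support_ne_nil, List.nodup_cons] at hd
    rw [SimpleGraph.Walk.cons_isPath_iff, SimpleGraph.Walk.isPath_def]
    refine ⟨ht, fun hx => ?_⟩
    rw [← List.dropLast_append_getLast p.support_ne_nil, List.mem_append,
      SimpleGraph.Walk.getLast_support, List.mem_singleton] at hx
    exact hx.elim hd.1 hxy

theorem IsGraphPath.isCycle {V : Type*} {G : SimpleGraph V} {x : V} {w : G.Walk x x}
    (hw : IsGraphPath G w) : w.IsCycle := by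
  obtain ⟨hl, he, -, ht⟩ := hw
  rw [SimpleGraph.Walk.isCycle_def]
  refine ⟨⟨he⟩, ?_, ht⟩
  rintro rfl
  simp at hl

theorem SimpleGraph.IsAcyclic.uniquePathProp {V : Type*} {G : SimpleGraph V}
    (hG : G.IsAcyclic) : UniquePathProp G := by
  intro x y w₁ w₂ h₁ h₂
  by_cases hxy : x = y
  · subst hxy
    exact absurd h₁.isCycle (hG w₁)
  · exact congrArg Subtype.val <|
      (hG.subsingleton_path x y).elim ⟨w₁, h₁.isPath hxy⟩ ⟨w₂, h₂.isPath hxy⟩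

theorem UniquePathProp.geodetical {V : Type*} {G : SimpleGraph V} (hG : UniquePathProp G)
    (lam : Sym2 V → ℝ) : Geodetical G lam :=
  fun x y w₁ w₂ h₁ h₂ => congrArg (walkLength lam) (hG x y w₁ w₂ h₁ h₂)

theorem SimpleGraph.exists_injOn_neighborSet {V : Type*} [Fintype V] (G : SimpleGraph V)
    [DecidableRel G.Adj] (v : V) :
    ∃ c : V → Fin (G.maxDegree + 1), Set.InjOn c (G.neighborSet v) := by
  have hle : (G.neighborFinset v).card ≤ G.maxDegree + 1 :=
    (G.degree_le_maxDegree v).trans (Nat.le_succ _)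
  classical
  refine ⟨fun u => if hu : u ∈ G.neighborFinset v then
    Fin.castLE hle ((G.neighborFinset v).equivFin ⟨u, hu⟩) else 0, fun u hu w hw huw => ?_⟩
  rw [SimpleGraph.mem_neighborSet] at hu hw
  simp only [SimpleGraph.mem_neighborFinset, hu, hw, dite_true] at huw
  exact congrArg Subtype.val ((G.neighborFinset v).equivFin.injective
    (Fin.castLE_injective hle huw))

/-- For a finite graph `G` with positive edge lengths and maximum degree
`Δ(G)`, the edge set of `G` can be covered by `Δ(G) + 1` geodetical subgraphs:
`t(G) ≤ Δ(G) + 1`. -/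
theorem coverNumber_le_maxDegree_succ {V : Type*} [Fintype V]
    (G : SimpleGraph V) [DecidableRel G.Adj]
    (lam : Sym2 V → ℝ) (hlam : ∀ e ∈ G.edgeSet, 0 < lam e) :
    coverNumber G lam ≤ G.maxDegree + 1 := by
  choose c hc using G.exists_injOn_neighborSet
  let _ : LinearOrder V := LinearOrder.lift' (Fintype.equivFin V) (Fintype.equivFin V).injective
  -- Each vertex colors the edges to its smaller neighbors with distinct colors.
  let f : Fin (G.maxDegree + 1) → SimpleGraph V := fun i =>
    { Adj := fun u v => G.Adj u v ∧ ((u < v ∧ c v u = i) ∨ (v < u ∧ c u v = i))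
      symm := ⟨fun u v h => ⟨h.1.symm, h.2.symm⟩⟩
      loopless := ⟨fun u h => G.loopless.irrefl u h.1⟩ }
  refine Nat.sInf_le ⟨f, fun i => ⟨fun u v h => h.1, ?_⟩, ?_⟩
  · refine (SimpleGraph.isAcyclic_of_unique_smaller_neighbor (f i) ?_).uniquePathProp.geodetical lam
    rintro v u w ⟨hvu, hu⟩ ⟨hvw, hw⟩ huv hwv
    have hcu : c v u = i := (hu.resolve_left fun h => h.1.not_gt huv).2
    have hcw : c v w = i := (hw.resolve_left fun h => h.1.not_gt hwv).2
    exact hc v hvu hvw (hcu.trans hcw.symm)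
  · intro e
    induction e using Sym2.ind with
    | _ u v =>
      intro he
      rw [SimpleGraph.mem_edgeSet] at he
      rcases lt_or_gt_of_ne he.ne with h | h
      · exact ⟨c v u, he, Or.inl ⟨h, rfl⟩⟩
      · exact ⟨c u v, he, Or.inr ⟨h, rfl⟩⟩
end
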